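/- arXiv:0910.0340 — 2 statements merged into one kernel-verified Lean document; each statement's English description precedes it below -/
import Mathlib

section
/- Let k be a field, let Λ be a finite partially ordered set, and let A = k[Λ] be its incidence algebra. For λ ∈ Λ, let M_λ be the one-dimensional simple right A-module on which e_{λλ} acts as the identity and all other basis elements e_{μν} act as zero. If λ > λ' in Λ and there is no γ ∈ Λ with λ > γ > λ' (i.e., λ covers λ'), then Ext^1_A(M_λ, M_{λ'}) ≅ k as k-vector spaces. -/
open CategoryTheory OrderDual

variable (k : Type u) [Field k] (Λ : Type u) [PartialOrder Λ] [Fintype Λ] [DecidableEq Λ]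
  [LocallyFiniteOrder Λ]

/-- Evaluation at `(λ, λ)` as a ring homomorphism from the opposite of the incidence
algebra `k[Λ]` to `k`. -/
def evalHom (l : Λ) : (IncidenceAlgebra k Λᵒᵈ)ᵐᵒᵖ →+* k where
  toFun f := f.unop (toDual l) (toDual l)
  map_one' := by simp
  map_mul' f g := by
    simp [IncidenceAlgebra.mul_apply, mul_comm]
  map_zero' := by simp
  map_add' f g := by simp

/-- The simple right `k[Λ]`-module `M_λ` attached to `λ ∈ Λ`: the underlying space is `k`,
the basis element `e_{λλ}` acts as the identity and all other basis elements act as zero;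
equivalently, `f ∈ k[Λ]` acts on `M_λ` by multiplication by `f λ λ`. -/
def SimpleM (l : Λ) : Type u := k

instance (l : Λ) : AddCommGroup (SimpleM k Λ l) := inferInstanceAs (AddCommGroup k)

instance (l : Λ) : Module k (SimpleM k Λ l) := inferInstanceAs (Module k k)

instance (l : Λ) : Module (IncidenceAlgebra k Λᵒᵈ)ᵐᵒᵖ (SimpleM k Λ l) :=
  Module.compHom k (evalHom k Λ l)

section Generic
open CategoryTheory Limits

variable {C : Type*} [Category* C] [Abelian C] [EnoughProjectives C]

/-- Projective cover of `K` followed by `K ⟶ P`, for `K ⟶ P ⟶ X` exact, is exact. -/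
theorem aux_exact {K P X : C} (i : K ⟶ P) (p : P ⟶ X) (w : i ≫ p = 0)
    (hex : (ShortComplex.mk i p w).Exact) :
    (ShortComplex.mk (Projective.π K ≫ i) p (by simp [w])).Exact := by
  let α : ShortComplex.mk (Projective.π K ≫ i) p (by simp [w]) ⟶ ShortComplex.mk i p w :=
    { τ₁ := Projective.π _
      τ₂ := 𝟙 _
      τ₃ := 𝟙 _ }
  have : Epi α.τ₁ := by dsimp [α]; infer_instance
  have : IsIso α.τ₂ := by dsimp [α]; infer_instance
  have : Mono α.τ₃ := by dsimp [α]; infer_instance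
  rw [ShortComplex.exact_iff_of_epi_of_isIso_of_mono α]
  exact hex

lemma aux_d {X Y : C} (f : X ⟶ Y) : Projective.d f ≫ f = 0 :=
  (Category.assoc _ _ _).trans ((congrArg (fun t => Projective.π (kernel f) ≫ t) (kernel.condition f)).trans comp_zero)

/-- Complex of a projective resolution starting with `over K ⟶ P`. -/
noncomputable def auxComplex {K P : C} (i : K ⟶ P) : ChainComplex C ℕ :=
  ChainComplex.mk' P (Projective.over K) (Projective.π K ≫ i)
    (fun {X₀ X₁} (f : X₁ ⟶ X₀) => ⟨Projective.syzygies f, Projective.d f, aux_d f⟩)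

lemma auxComplex_d {K P : C} (i : K ⟶ P) : (auxComplex i).d 1 0 = Projective.π K ≫ i := by
  simp [auxComplex]

lemma of_exactAt_succ (X : ℕ → C) (d : ∀ n, X (n + 1) ⟶ X n) (sq : ∀ n, d (n + 1) ≫ d n = 0)
    (h : ∀ n, (ShortComplex.mk (d (n + 1)) (d n) (sq n)).Exact) (n : ℕ) :
    (ChainComplex.of X d sq).ExactAt (n + 1) := by
  rw [HomologicalComplex.exactAt_iff' _ (n + 1 + 1) (n + 1) n (by simp) (by simp)]
  refine (ShortComplex.exact_iff_of_iso (ShortComplex.isoMk (Iso.refl (X (n + 2)))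
    (Iso.refl (X (n + 1))) (Iso.refl (X n)) ?_ ?_)).1 (h n)
  · have := ChainComplex.of_d X d (n + 1)
    exact (Category.id_comp _).trans (this.trans (Category.comp_id _).symm)
  · have := ChainComplex.of_d X d n
    exact (Category.id_comp _).trans (this.trans (Category.comp_id _).symm)

lemma aux_sq {K P : C} (i : K ⟶ P) (n : ℕ) :
    (ChainComplex.mkAux P (Projective.over K) (Projective.syzygies (Projective.π K ≫ i))
      (Projective.π K ≫ i) (Projective.d (Projective.π K ≫ i)) (aux_d _)
      (fun S => ⟨Projective.syzygies S.f, Projective.d S.f, aux_d S.f⟩) (n + 1)).g ≫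
    (ChainComplex.mkAux P (Projective.over K) (Projective.syzygies (Projective.π K ≫ i))
      (Projective.π K ≫ i) (Projective.d (Projective.π K ≫ i)) (aux_d _)
      (fun S => ⟨Projective.syzygies S.f, Projective.d S.f, aux_d S.f⟩) n).g = 0 :=
  (ChainComplex.mkAux P (Projective.over K) (Projective.syzygies (Projective.π K ≫ i))
      (Projective.π K ≫ i) (Projective.d (Projective.π K ≫ i)) (aux_d _)
      (fun S => ⟨Projective.syzygies S.f, Projective.d S.f, aux_d S.f⟩) n).zero

lemma auxComplex_exactAt_succ {K P : C} (i : K ⟶ P) (n : ℕ) :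
    (auxComplex i).ExactAt (n + 1) := by
  refine of_exactAt_succ _ _ (aux_sq i) (fun n => ?_) n
  match n with
  | 0 => exact exact_d_f (Projective.π K ≫ i)
  | n + 1 => exact exact_d_f _

lemma auxComplex_projective {K P : C} (i : K ⟶ P) [Projective P] (n : ℕ) :
    Projective ((auxComplex i).X n) := by
  obtain (_ | _ | _ | n) := n
  · assumption
  all_goals apply Projective.projective_over

/-- The resolution. -/
noncomputable def auxRes {K P X : C} (i : K ⟶ P) (p : P ⟶ X) (w : i ≫ p = 0)
    (hex : (ShortComplex.mk i p w).Exact) [Projective P] [Epi p] : ProjectiveResolution X where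
  complex := auxComplex i
  projective := auxComplex_projective i
  π := (ChainComplex.toSingle₀Equiv _ _).symm ⟨p, by
          have h : (Projective.π K ≫ i) ≫ p = 0 := by rw [Category.assoc, w, comp_zero]
          exact (congrArg (fun t : Projective.over K ⟶ P => t ≫ p) (auxComplex_d i)).trans h⟩
  quasiIso := ⟨fun n => by
    cases n
    · rw [ChainComplex.quasiIsoAt₀_iff, ShortComplex.quasiIso_iff_of_zeros']
      · refine (ShortComplex.exact_and_epi_g_iff_of_iso ?_).2
          ⟨aux_exact i p w hex, by dsimp; infer_instance⟩
        refine ShortComplex.isoMk (Iso.refl (Projective.over K)) (Iso.refl P) (Iso.refl X)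
          ?_ ?_
        · exact (Category.id_comp _).trans
            ((auxComplex_d i).symm.trans (Category.comp_id _).symm)
        · refine (Category.id_comp _).trans
            (Eq.trans ?_ (Category.comp_id _).symm)
          exact (ChainComplex.toSingle₀Equiv_symm_apply_f_zero (C := auxComplex i) p _).symm
      all_goals rfl
    · rw [quasiIsoAt_iff_exactAt']
      · apply auxComplex_exactAt_succ
      · apply ChainComplex.exactAt_succ_single_obj⟩

variable (R : Type*) [Ring R] [Linear R C]

theorem aux_ext' {K X Y : C} (Q : ProjectiveResolution X) (q : Q.complex.X 1 ⟶ K)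
    (i : K ⟶ Q.complex.X 0) [Mono i] [Epi q] (hd : Q.complex.d 1 0 = q ≫ i)
    (hY : ∀ f : Q.complex.X 0 ⟶ Y, f = 0) :
    Nonempty ((((Ext R C 1).obj (Opposite.op X)).obj Y) ≃ₗ[R] (K ⟶ Y)) := by
  let L := Q.complex.linearYonedaObj R Y
  have hf : (L.sc' 0 1 2).f = 0 := by
    ext (x : _ ⟶ _)
    obtain rfl : x = 0 := hY x
    exact map_zero (L.sc' 0 1 2).f.hom
  have e1 : L.homology 1 ≅ (L.sc' 0 1 2).homology :=
    ShortComplex.homologyMapIso (L.isoSc' 0 1 2 (by simp) (by simp))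
  have := (L.sc' 0 1 2).isIso_homologyπ hf
  have e2 : (L.sc' 0 1 2).homology ≅ ModuleCat.of R (LinearMap.ker (L.sc' 0 1 2).g.hom) :=
    (asIso (L.sc' 0 1 2).homologyπ).symm ≪≫ (L.sc' 0 1 2).moduleCatCyclesIso
  refine ⟨((Q.isoExt 1 Y) ≪≫ e1 ≪≫ e2).toLinearEquiv ≪≫ₗ LinearEquiv.symm ?_⟩
  have hz : Q.complex.d 2 1 ≫ q = 0 := by
    have := Q.complex.d_comp_d 2 1 0
    rw [hd, ← Category.assoc] at this
    exact zero_of_comp_mono i this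
  have hex2 : (ShortComplex.mk (Q.complex.d 2 1) (q) hz).Exact := by
    have h0 := Q.exact_succ 0
    let α : ShortComplex.mk (Q.complex.d 2 1) (q) hz ⟶
       ShortComplex.mk _ _ (Q.complex.d_comp_d 2 1 0) :=
      { τ₁ := 𝟙 _
        τ₂ := 𝟙 _
        τ₃ := i
        comm₁₂ := by simp
        comm₂₃ := by dsimp; rw [hd]; simp }
    have : Epi α.τ₁ := by dsimp [α]; infer_instance
    have : IsIso α.τ₂ := by dsimp [α]; infer_instance
    have : Mono α.τ₃ := by dsimp [α]; infer_instance
    rw [ShortComplex.exact_iff_of_epi_of_isIso_of_mono α]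
    exact h0
  refine LinearEquiv.ofBijective (LinearMap.codRestrict _
    (Linear.leftComp R Y (q)) ?_) ⟨?_, ?_⟩
  · intro c
    change Q.complex.d 2 1 ≫ q ≫ c = 0
    rw [← Category.assoc, hz, zero_comp]
  · intro a b hab
    have : q ≫ a = q ≫ b := congrArg Subtype.val hab
    exact (cancel_epi _).1 this
  · rintro ⟨φ, hφ⟩
    have hφ' : Q.complex.d 2 1 ≫ φ = 0 := hφ
    have : Epi (ShortComplex.mk (Q.complex.d 2 1) (q) hz).g := by
      dsimp; infer_instance
    exact ⟨hex2.desc φ hφ', Subtype.ext (hex2.g_desc φ hφ')⟩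

theorem aux_ext {K P X Y : C} (i : K ⟶ P) (p : P ⟶ X) (w : i ≫ p = 0)
    (hex : (ShortComplex.mk i p w).Exact) [Projective P] [Epi p] [hi : Mono i]
    (hY : ∀ f : P ⟶ Y, f = 0) :
    Nonempty ((((Ext R C 1).obj (Opposite.op X)).obj Y) ≃ₗ[R] (K ⟶ Y)) :=
  @aux_ext' C _ _ _ R _ _ K X Y (auxRes i p w hex) (Projective.π K) i hi
    (inferInstanceAs (Epi (Projective.π K))) (auxComplex_d i) hY

end Generic

section Concrete

/-- The opposite incidence algebra. -/
abbrev BB := (IncidenceAlgebra k Λᵒᵈ)ᵐᵒᵖ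

lemma BB_mul (b c : BB k Λ) (x y : Λᵒᵈ) :
    (b * c).unop x y = ∑ z ∈ Finset.Icc x y, c.unop x z * b.unop z y := rfl

lemma simpleM_smul (l : Λ) (b : BB k Λ) (m : SimpleM k Λ l) :
    b • m = (b.unop (toDual l) (toDual l) * (show k from m) : k) := rfl

/-- matrix unit -/
def EE {x y : Λᵒᵈ} (h : x ≤ y) : BB k Λ :=
  MulOpposite.op ⟨fun a b => if a = x ∧ b = y then 1 else 0, fun a b hab => by
    rw [if_neg]; rintro ⟨rfl, rfl⟩; exact hab h⟩

lemma EE_apply {x y : Λᵒᵈ} (h : x ≤ y) (a b : Λᵒᵈ) :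
    (EE k Λ h).unop a b = if a = x ∧ b = y then 1 else 0 := rfl

lemma algMap_apply (c : k) (a b : Λᵒᵈ) :
    (algebraMap k (BB k Λ) c).unop a b = if a = b then c else 0 := by
  change (c • (1 : IncidenceAlgebra k Λᵒᵈ)) a b = _
  simp [IncidenceAlgebra.constSMul_apply]

/-- The projective `e_l A`. -/
def PP (l : Λ) : Submodule (BB k Λ) (BB k Λ) where
  carrier := {b | ∀ x y, x ≠ toDual l → b.unop x y = 0}
  zero_mem' := fun x y _ => rfl
  add_mem' := by
    intro a b ha hb x y hx
    change a.unop x y + b.unop x y = 0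
    rw [ha x y hx, hb x y hx, add_zero]
  smul_mem' := by
    intro c b hb x y hx
    change (c * b).unop x y = 0
    rw [BB_mul]
    exact Finset.sum_eq_zero fun z _ => by rw [hb x z hx, zero_mul]

lemma EE_mem (l : Λ) {y : Λᵒᵈ} (h : toDual l ≤ y) : EE k Λ h ∈ PP k Λ l := by
  intro a b ha
  rw [EE_apply, if_neg (fun h => ha h.1)]

lemma PP_mul (l : Λ) (b : BB k Λ) (hb : b ∈ PP k Λ l) : b * EE k Λ (le_refl (toDual l)) = b := by
  apply MulOpposite.unop_injective
  ext x y hxy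
  rw [BB_mul]
  by_cases hx : x = toDual l
  · rw [hx] at hxy ⊢
    rw [Finset.sum_eq_single (toDual l)]
    · simp [EE_apply]
    · intro z _ hz
      simp [EE_apply, hz]
    · intro h; simp [hxy] at h
  · rw [hb x y hx]
    exact Finset.sum_eq_zero fun z _ => by simp [EE_apply, hx]

lemma PP_proj (l : Λ) : Module.Projective (BB k Λ) (PP k Λ l) := by
  refine Module.Projective.of_split (PP k Λ l).subtype
    (LinearMap.codRestrict (PP k Λ l)
      (LinearMap.toSpanSingleton (BB k Λ) (BB k Λ) (EE k Λ (le_refl (toDual l)))) ?_) ?_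
  · intro c
    exact (PP k Λ l).smul_mem c (EE_mem k Λ l _)
  · ext b : 2
    exact PP_mul k Λ l b.1 b.2

/-- the augmentation -/
def PPpi (l : Λ) : PP k Λ l →ₗ[BB k Λ] SimpleM k Λ l where
  toFun b := b.1.unop (toDual l) (toDual l)
  map_add' _ _ := rfl
  map_smul' c b := by
    change (c * b.1).unop _ _ = c.unop _ _ * b.1.unop _ _
    rw [BB_mul]
    simp [mul_comm]

lemma PPpi_surj (l : Λ) : Function.Surjective (PPpi k Λ l) := by
  intro (c : k)
  refine ⟨(algebraMap k (BB k Λ) c) • ⟨_, EE_mem k Λ l (le_refl (toDual l))⟩, ?_⟩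
  rw [map_smul, simpleM_smul]
  change (algebraMap k (BB k Λ) c).unop (toDual l) (toDual l) *
    (EE k Λ (le_refl (toDual l))).unop (toDual l) (toDual l) = c
  rw [algMap_apply, EE_apply]
  simp

lemma PP_hom_zero (l l' : Λ) (h : l ≠ l') (f : PP k Λ l →ₗ[BB k Λ] SimpleM k Λ l') : f = 0 := by
  let e : PP k Λ l := ⟨_, EE_mem k Λ l (le_refl (toDual l))⟩
  have he (p : PP k Λ l) : p = p.1 • e := Subtype.ext (PP_mul k Λ l p.1 p.2).symm
  have hfe : f e = 0 := by
    rw [he e, map_smul, simpleM_smul]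
    change (EE k Λ (le_refl (toDual l))).unop _ _ * _ = (0 : k)
    rw [EE_apply, if_neg, zero_mul]
    rintro ⟨h1, -⟩
    exact h (toDual.injective h1).symm
  ext p
  rw [he p, map_smul, hfe, smul_zero, LinearMap.zero_apply]

/-- The kernel. -/
def KK (l : Λ) : Submodule (BB k Λ) (BB k Λ) where
  carrier := {b | b ∈ PP k Λ l ∧ b.unop (toDual l) (toDual l) = 0}
  zero_mem' := ⟨(PP k Λ l).zero_mem, rfl⟩
  add_mem' := by
    intro a b ha hb
    refine ⟨(PP k Λ l).add_mem ha.1 hb.1, ?_⟩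
    change a.unop (toDual l) (toDual l) + b.unop (toDual l) (toDual l) = 0
    rw [ha.2, hb.2, add_zero]
  smul_mem' := by
    intro c b hb
    refine ⟨(PP k Λ l).smul_mem c hb.1, ?_⟩
    change (c * b).unop _ _ = 0
    rw [BB_mul]
    simp [hb.2]

/-- The generator `e_{l l'}`. -/
def rr (l l' : Λ) (h : l' < l) : KK k Λ l :=
  ⟨EE k Λ (toDual_le_toDual.2 h.le), EE_mem k Λ l _, by
    rw [EE_apply, if_neg]
    · rintro ⟨-, h2⟩
      exact h.ne (toDual.injective h2).symm⟩

lemma KK_inj (l l' : Λ) (h : l' < l) (φ : KK k Λ l →ₗ[BB k Λ] SimpleM k Λ l')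
    (h0 : φ (rr k Λ l l' h) = 0) : φ = 0 := by
  ext r
  have h1 : EE k Λ (le_refl (toDual l')) • r =
      algebraMap k (BB k Λ) (r.1.unop (toDual l) (toDual l')) • rr k Λ l l' h := by
    apply Subtype.ext
    change EE k Λ (le_refl (toDual l')) * r.1 = algebraMap k (BB k Λ) _ * EE k Λ (toDual_le_toDual.2 h.le)
    apply MulOpposite.unop_injective
    ext x y hxy
    rw [BB_mul, BB_mul]
    simp only [EE_apply, algMap_apply]
    by_cases hx : x = toDual l
    · rw [hx] at hxy ⊢
      by_cases hy : y = toDual l'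
      · rw [hy] at hxy ⊢
        simp [hxy]
      · simp [hy]
    · simp [hx, r.2.1 x _ hx]
  have h2 := congrArg φ h1
  rw [map_smul, map_smul, h0, smul_zero, simpleM_smul, EE_apply, if_pos ⟨rfl, rfl⟩, one_mul] at h2
  exact h2

/-- evaluation at `l'` times `c` -/
def psi (l l' : Λ) (h : l' ⋖ l) (c : k) : KK k Λ l →ₗ[BB k Λ] SimpleM k Λ l' where
  toFun r := (c * r.1.unop (toDual l) (toDual l') : k)
  map_add' r s := mul_add c (r.1.unop (toDual l) (toDual l')) (s.1.unop (toDual l) (toDual l'))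
  map_smul' b r := by
    change c * (b * r.1).unop _ _ = b.unop _ _ * (c * r.1.unop _ _)
    rw [BB_mul, Finset.sum_eq_single (toDual l')]
    · ring
    · intro z hz hz'
      rw [Finset.mem_Icc] at hz
      have hzl : z = toDual l := by
        by_contra hne
        exact h.2 (lt_of_le_of_ne (show l' ≤ ofDual z from hz.2) (fun e => hz' e.symm))
          (lt_of_le_of_ne (show ofDual z ≤ l from hz.1) hne)
      rw [hzl]
      have : r.1.unop (toDual l) (toDual l) = 0 := r.2.2
      rw [this, zero_mul]
    · intro hn
      exact absurd (Finset.mem_Icc.2 ⟨(toDual_le_toDual.2 h.1.le : toDual l ≤ toDual l'), le_rfl⟩) hn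

theorem hom_equiv (l l' : Λ) (h : l' ⋖ l) :
    Nonempty ((ModuleCat.of.{u} (BB k Λ) (KK k Λ l) ⟶
      ModuleCat.of.{u} (BB k Λ) (SimpleM k Λ l')) ≃ₗ[k] k) := by
  let ev (φ : ModuleCat.of.{u} (BB k Λ) (KK k Λ l) ⟶
      ModuleCat.of.{u} (BB k Λ) (SimpleM k Λ l')) : k := φ.hom (rr k Λ l l' h.1)
  have hsmul (c : k) (φ) : ev (c • φ) = c * ev φ := by
    change algebraMap k (BB k Λ) c • φ.hom (rr k Λ l l' h.1) = _
    refine (simpleM_smul k Λ l' _ _).trans ?_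
    rw [algMap_apply, if_pos rfl]
  let F : (ModuleCat.of.{u} (BB k Λ) (KK k Λ l) ⟶
      ModuleCat.of.{u} (BB k Λ) (SimpleM k Λ l')) →ₗ[k] k :=
    { toFun := ev
      map_add' := fun _ _ => rfl
      map_smul' := hsmul }
  refine ⟨LinearEquiv.ofBijective F ⟨?_, ?_⟩⟩
  · refine (injective_iff_map_eq_zero F).2 fun φ hφ => ?_
    exact ModuleCat.hom_ext (KK_inj k Λ l l' h.1 φ.hom hφ)
  · intro (c : k)
    refine ⟨ModuleCat.ofHom (psi k Λ l l' h c), ?_⟩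
    change c * (EE k Λ (toDual_le_toDual.2 h.1.le)).unop (toDual l) (toDual l') = c
    simp [EE_apply]

end Concrete

/-- Let `k` be a field, `Λ` a finite poset and `A = k[Λ]` its incidence algebra (the
Mathlib incidence algebra of the dual order; right `A`-modules are `Aᵐᵒᵖ`-modules). If
`λ` covers `λ'` (i.e. `λ > λ'` with no `γ` in between, `λ' ⋖ λ`), then
`Ext¹_A(M_λ, M_λ') ≅ k` as `k`-vector spaces. -/
theorem ext_one_of_covby (l l' : Λ) (h : l' ⋖ l) :
    Nonempty
      ((((Ext k (ModuleCat.{u} (IncidenceAlgebra k Λᵒᵈ)ᵐᵒᵖ) 1).obj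
          (Opposite.op (ModuleCat.of _ (SimpleM k Λ l)))).obj
            (ModuleCat.of _ (SimpleM k Λ l'))) ≃ₗ[k] k) := by
  have hle : KK k Λ l ≤ PP k Λ l := fun _ hb => hb.1
  let i : ModuleCat.of.{u} (BB k Λ) (KK k Λ l) ⟶ ModuleCat.of.{u} (BB k Λ) (PP k Λ l) :=
    ModuleCat.ofHom (Submodule.inclusion hle)
  let p : ModuleCat.of.{u} (BB k Λ) (PP k Λ l) ⟶ ModuleCat.of.{u} (BB k Λ) (SimpleM k Λ l) :=
    ModuleCat.ofHom (PPpi k Λ l)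
  have w : i ≫ p = 0 := by
    ext x
    exact x.2.2
  have hex : (ShortComplex.mk i p w).Exact := by
    rw [ShortComplex.moduleCat_exact_iff]
    intro x hx
    exact ⟨⟨x.1, x.2, hx⟩, rfl⟩
  have : Module.Projective (BB k Λ) (PP k Λ l) := PP_proj k Λ l
  have : Projective (ModuleCat.of.{u} (BB k Λ) (PP k Λ l)) := inferInstance
  have : Epi p := (ModuleCat.epi_iff_surjective p).2 (PPpi_surj k Λ l)
  have : Mono i := (ModuleCat.mono_iff_injective i).2 (Submodule.inclusion_injective hle)
  obtain ⟨e1⟩ := aux_ext k (Y := ModuleCat.of.{u} (BB k Λ) (SimpleM k Λ l')) i p w hex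
    (fun f => ModuleCat.hom_ext (PP_hom_zero k Λ l l' h.1.ne' f.hom))
  obtain ⟨e2⟩ := hom_equiv k Λ l l' h
  exact ⟨e1.trans e2⟩
end

section
/- Let k be a field, let Λ be a finite partially ordered set, and let A = k[Λ] be its incidence algebra. For λ, λ' ∈ Λ, if it is NOT the case that λ covers λ' (i.e., it is not the case that λ > λ' with no γ satisfying λ > γ > λ'), then Ext^1_A(M_λ, M_{λ'}) = 0, where M_λ and M_{λ'} are the one-dimensional simple right A-modules associated to λ and λ'. -/
open CategoryTheory OrderDual

variable (k : Type u) [Field k] (Λ : Type u) [PartialOrder Λ] [Fintype Λ] [DecidableEq Λ]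
  [LocallyFiniteOrder Λ]

open Classical in
/-- Matrix unit `e_{ab}` (zero unless `a ≤ b`) in the incidence algebra of the dual order. -/
noncomputable def unitE (a b : Λᵒᵈ) (c : k) : IncidenceAlgebra k Λᵒᵈ where
  toFun x y := if x = a ∧ y = b ∧ x ≤ y then c else 0
  eq_zero_of_not_le' x y h := by simp [h]

open Classical in
lemma unitE_apply (a b x y : Λᵒᵈ) (c : k) :
    unitE k Λ a b c x y = if x = a ∧ y = b ∧ x ≤ y then c else 0 := rfl

lemma unitE_add (a b : Λᵒᵈ) (c c' : k) :
    unitE k Λ a b (c + c') = unitE k Λ a b c + unitE k Λ a b c' := by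
  ext x y h
  simp only [IncidenceAlgebra.add_apply, unitE_apply]
  split_ifs <;> simp

open Classical in
lemma unitE_mul (a b : Λᵒᵈ) (c : k) (f : IncidenceAlgebra k Λᵒᵈ) (x y : Λᵒᵈ) :
    (unitE k Λ a b c * f) x y = if x = a ∧ a ≤ b then c * f b y else 0 := by
  rw [IncidenceAlgebra.mul_apply]
  rw [Finset.sum_eq_single b]
  · rw [unitE_apply]
    by_cases hx : x = a
    · subst hx; simp
    · simp [hx]
  · intro z _ hz
    simp [unitE_apply, hz]
  · intro hb
    rw [Finset.mem_Icc] at hb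
    rw [unitE_apply]
    by_cases hxb : x ≤ b
    · rw [f.apply_eq_zero_of_not_le (fun h => hb ⟨hxb, h⟩)]; simp
    · simp [hxb]

open Classical in
lemma mul_unitE (a b : Λᵒᵈ) (c : k) (f : IncidenceAlgebra k Λᵒᵈ) (x y : Λᵒᵈ) :
    (f * unitE k Λ a b c) x y = if y = b ∧ a ≤ b then f x a * c else 0 := by
  rw [IncidenceAlgebra.mul_apply]
  rw [Finset.sum_eq_single a]
  · rw [unitE_apply]
    by_cases hx : y = b
    · subst hx; simp
    · simp [hx]
  · intro z _ hz
    simp [unitE_apply, hz]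
  · intro hb
    rw [Finset.mem_Icc] at hb
    rw [unitE_apply]
    by_cases hxb : a ≤ y
    · rw [f.apply_eq_zero_of_not_le (fun h => hb ⟨h, hxb⟩)]; simp
    · simp [hxb]

lemma simpleM_smul_s11 (l : Λ) (a : (IncidenceAlgebra k Λᵒᵈ)ᵐᵒᵖ) (m : SimpleM k Λ l) :
    a • m = a.unop (toDual l) (toDual l) • m := rfl

/-- The identity, from `M_l` to `k`. -/
def ofM (l : Λ) : SimpleM k Λ l ≃ₗ[k] k := LinearEquiv.refl k k

lemma extend_map (l l' : Λ) (h : ¬ l' ⋖ l) {P₁ P₀ : Type*} [AddCommGroup P₁] [AddCommGroup P₀]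
    [Module (IncidenceAlgebra k Λᵒᵈ)ᵐᵒᵖ P₁] [Module (IncidenceAlgebra k Λᵒᵈ)ᵐᵒᵖ P₀]
    (d : P₁ →ₗ[(IncidenceAlgebra k Λᵒᵈ)ᵐᵒᵖ] P₀)
    (π : P₀ →ₗ[(IncidenceAlgebra k Λᵒᵈ)ᵐᵒᵖ] SimpleM k Λ l)
    (f : P₁ →ₗ[(IncidenceAlgebra k Λᵒᵈ)ᵐᵒᵖ] SimpleM k Λ l')
    (hex : ∀ x, π x = 0 → ∃ y, d y = x) (hd : ∀ y, π (d y) = 0)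
    (hs : Function.Surjective π) (hf : ∀ y, d y = 0 → f y = 0) :
    ∃ g : P₀ →ₗ[(IncidenceAlgebra k Λᵒᵈ)ᵐᵒᵖ] SimpleM k Λ l', ∀ y, g (d y) = f y := by
  obtain ⟨p, hp⟩ := hs ((ofM k Λ l).symm 1)
  have hf2 : ∀ y z, d y = d z → f y = f z := by
    intro y z hyz
    have := hf (y - z) (by rw [map_sub, hyz, sub_self])
    rwa [map_sub, sub_eq_zero] at this
  -- `T c = p · (c e_{ll})`
  let T : SimpleM k Λ l → P₀ :=
    fun c => MulOpposite.op (unitE k Λ (toDual l) (toDual l) (ofM k Λ l c)) • p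
  have hT : ∀ c, π (T c) = c := by
    intro c
    change π (MulOpposite.op (unitE k Λ (toDual l) (toDual l) (ofM k Λ l c)) • p) = _
    rw [map_smul, hp, simpleM_smul_s11, MulOpposite.unop_op, unitE_apply,
      if_pos ⟨rfl, rfl, le_rfl⟩, ← map_smul, smul_eq_mul, mul_one, LinearEquiv.symm_apply_apply]
  have hTadd : ∀ c c', T (c + c') = T c + T c' := by
    intro c c'
    change MulOpposite.op (unitE k Λ _ _ (ofM k Λ l (c + c'))) • p = _
    rw [map_add, unitE_add, MulOpposite.op_add, add_smul]
  have hy : ∀ x, ∃ y, d y = x - T (π x) := by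
    intro x
    apply hex
    rw [map_sub, hT]
    exact sub_self _
  choose s hs' using hy
  have hg : ∀ x y, d y = x - T (π x) → f (s x) = f y := fun x y hy =>
    hf2 _ _ ((hs' x).trans hy.symm)
  -- key vanishing
  have key : ∀ (a : IncidenceAlgebra k Λᵒᵈ) (c : SimpleM k Λ l) (y : P₁),
      d y = MulOpposite.op a • T c - T (a (toDual l) (toDual l) • c) → f y = 0 := by
    intro a c' y hy
    obtain ⟨c, hc⟩ : ∃ c, c = ofM k Λ l c' := ⟨_, rfl⟩
    have h1 : f y = f (MulOpposite.op (unitE k Λ (toDual l') (toDual l') 1) • y) := by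
      rw [map_smul, simpleM_smul_s11, MulOpposite.unop_op, unitE_apply,
        if_pos ⟨rfl, rfl, le_rfl⟩, one_smul]
    rw [h1]
    have h2 : d (MulOpposite.op (unitE k Λ (toDual l') (toDual l') 1) • y) =
        MulOpposite.op ((unitE k Λ (toDual l) (toDual l) c * a -
          unitE k Λ (toDual l) (toDual l) (a (toDual l) (toDual l) * c)) *
            unitE k Λ (toDual l') (toDual l') 1) • p := by
      rw [map_smul, hy]
      simp only [T, map_smul, smul_eq_mul, ← hc, MulOpposite.op_mul, MulOpposite.op_sub, mul_smul, sub_smul]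
    by_cases hlt : l' < l
    · obtain ⟨g, hg1, hg2⟩ : ∃ g, l' < g ∧ g < l := by
        by_contra hcon
        push Not at hcon
        exact h ⟨hlt, fun g h1 h2 => hcon g h1 h2⟩
      have h3 : (unitE k Λ (toDual l) (toDual l) c * a -
          unitE k Λ (toDual l) (toDual l) (a (toDual l) (toDual l) * c)) *
            unitE k Λ (toDual l') (toDual l') 1 =
          unitE k Λ (toDual l) (toDual g) (c * a (toDual l) (toDual l')) *
            unitE k Λ (toDual g) (toDual l') 1 := by
        ext x z hxz
        have e1 : (toDual l : Λᵒᵈ) ≤ toDual g := hg2.le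
        have e2 : (toDual g : Λᵒᵈ) ≤ toDual l' := hg1.le
        have e3 : (toDual l' : Λᵒᵈ) ≠ toDual l := fun hh => hlt.ne hh
        rw [mul_unitE, unitE_mul, IncidenceAlgebra.sub_apply, unitE_mul, unitE_apply, unitE_apply]
        by_cases hx : x = toDual l <;> by_cases hz : z = toDual l' <;>
          simp [hx, hz, e1, e2, e3]
      obtain ⟨w, hw⟩ := hex
        (MulOpposite.op (unitE k Λ (toDual l) (toDual g) (c * a (toDual l) (toDual l'))) • p) (by
          rw [map_smul, simpleM_smul_s11]
          have e3 : (toDual l : Λᵒᵈ) ≠ toDual g := fun hh => hg2.ne' hh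
          rw [MulOpposite.unop_op, unitE_apply, if_neg (fun hh => e3 hh.2.1), zero_smul])
      rw [h3, MulOpposite.op_mul, mul_smul, ← hw, ← map_smul] at h2
      rw [hf2 _ _ h2, map_smul, simpleM_smul_s11]
      have e3 : (toDual l' : Λᵒᵈ) ≠ toDual g := fun hh => hg1.ne hh
      rw [MulOpposite.unop_op, unitE_apply, if_neg (fun hh => e3 hh.1), zero_smul]
    · apply hf
      rw [h2]
      have h3 : (unitE k Λ (toDual l) (toDual l) c * a -
          unitE k Λ (toDual l) (toDual l) (a (toDual l) (toDual l) * c)) *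
            unitE k Λ (toDual l') (toDual l') 1 = 0 := by
        ext x z hxz
        rw [mul_unitE, IncidenceAlgebra.sub_apply, unitE_mul, unitE_apply]
        by_cases hx : x = toDual l
        · by_cases hll : l' = l
          · subst hll
            simp [hx, mul_comm]
          · have e4 : ¬ (toDual l : Λᵒᵈ) ≤ toDual l' := fun hh =>
              hlt (lt_of_le_of_ne hh hll)
            rw [a.apply_eq_zero_of_not_le e4]
            have e3 : (toDual l' : Λᵒᵈ) ≠ toDual l := fun hh => hll hh
            simp [e3]
        · simp [hx]
      rw [h3]
      exact zero_smul (IncidenceAlgebra k Λᵒᵈ)ᵐᵒᵖ p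
  refine ⟨{ toFun := fun x => f (s x), map_add' := ?_, map_smul' := ?_ }, ?_⟩
  · intro x x'
    rw [← map_add]
    apply hg
    have : T (π (x + x')) = T (π x) + T (π x') := by
      rw [map_add]; exact hTadd _ _
    rw [map_add, hs', hs', this]
    abel
  · intro a x
    obtain ⟨y, hy⟩ := hex (a • T (π x) - T (a.unop (toDual l) (toDual l) • π x)) (by
      rw [map_sub, map_smul, hT, hT, simpleM_smul_s11]
      exact sub_self _)
    have h1 : f (s (a • x)) = f (a • s x + y) := by
      apply hg
      have : T (π (a • x)) = T (a.unop (toDual l) (toDual l) • π x) := by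
        rw [map_smul]; rfl
      rw [map_add, map_smul, hs', hy, this, smul_sub]
      abel
    rw [h1, map_add, key a.unop (π x) y hy, add_zero, map_smul]
    rfl
  · intro y
    apply hg
    rw [hd]
    have : T 0 = 0 := by
      have := hTadd 0 0
      rw [add_zero] at this
      exact left_eq_add.mp this
    rw [this, sub_zero]

/-- Let `k` be a field, `Λ` a finite poset and `A = k[Λ]` its incidence algebra (the
Mathlib incidence algebra of the dual order; right `A`-modules are `Aᵐᵒᵖ`-modules). If
`λ` does NOT cover `λ'` (i.e. it is not the case that `λ > λ'` with no `γ` in between),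
then `Ext¹_A(M_λ, M_λ') = 0`. -/
theorem ext_one_eq_zero_of_not_covby (l l' : Λ) (h : ¬ l' ⋖ l) :
    Subsingleton
      ((((Ext k (ModuleCat.{u} (IncidenceAlgebra k Λᵒᵈ)ᵐᵒᵖ) 1).obj
          (Opposite.op (ModuleCat.of _ (SimpleM k Λ l)))).obj
            (ModuleCat.of _ (SimpleM k Λ l')))) := by
  let P : ProjectiveResolution (ModuleCat.of (IncidenceAlgebra k Λᵒᵈ)ᵐᵒᵖ (SimpleM k Λ l)) :=
    ProjectiveResolution.of _
  apply ModuleCat.subsingleton_of_isZero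
  refine Limits.IsZero.of_iso ?_ (P.isoExt 1 _)
  rw [← HomologicalComplex.exactAt_iff_isZero_homology,
    HomologicalComplex.exactAt_iff' _ 0 1 2 (by simp) (by simp),
    ShortComplex.moduleCat_exact_iff]
  intro (f : P.complex.X 1 ⟶ _) hf
  have hf' : P.complex.d 2 1 ≫ f = 0 := hf
  have e1 := P.exact_succ 0
  have e0 := P.exact₀
  rw [ShortComplex.moduleCat_exact_iff] at e0 e1
  have hsurj : Function.Surjective (P.π.f 0) :=
    (ModuleCat.epi_iff_surjective _).1 inferInstance
  obtain ⟨g, hg⟩ := extend_map k Λ l l' h (P.complex.d 1 0).hom (P.π.f 0).hom f.hom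
    (fun x hx => e0 x hx)
    (fun y => LinearMap.congr_fun (congrArg ModuleCat.Hom.hom P.complex_d_comp_π_f_zero) y)
    hsurj
    (fun y hy => by
      obtain ⟨z, hz⟩ := e1 y hy
      rw [← hz]
      exact LinearMap.congr_fun (congrArg ModuleCat.Hom.hom hf') z)
  refine ⟨(ModuleCat.ofHom g : P.complex.X 0 ⟶ _), ?_⟩
  change P.complex.d 1 0 ≫ ModuleCat.ofHom g = f
  ext y
  exact hg y
end
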